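/- There exist no reals b, c such that, setting a = 1 − 5b − 3c and λ = (a, b, b, b, b, b, c, c, c), one has a > b > c > 0, l₂(λ) = 0, and L₁(λ) positive semidefinite. -/

import Mathlib

noncomputable section

/-- The matrix `L₁(x)` for a vector `x = (x₁,…,x₉)` (indexed as `x 0, …, x 8`). -/
def L1m (x : Fin 9 → ℝ) : Matrix (Fin 3) (Fin 3) ℝ :=
  !![2 * x 8, x 7 - x 0, x 5 - x 1;
     x 7 - x 0, 2 * x 6, x 4 - x 2;
     x 5 - x 1, x 4 - x 2, 2 * x 3]

/-- The matrix `L₂(x)` for a vector `x = (x₁,…,x₉)` (indexed as `x 0, …, x 8`). -/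
def L2m (x : Fin 9 → ℝ) : Matrix (Fin 3) (Fin 3) ℝ :=
  !![2 * x 8, x 7 - x 0, x 6 - x 1;
     x 7 - x 0, 2 * x 5, x 4 - x 2;
     x 6 - x 1, x 4 - x 2, 2 * x 3]

/-- `l₁(x) = det L₁(x)`. -/
def l1 (x : Fin 9 → ℝ) : ℝ := (L1m x).det

/-- `l₂(x) = det L₂(x)`. -/
def l2 (x : Fin 9 → ℝ) : ℝ := (L2m x).det

/-- there are no reals b, c with a = 1 − 5b − 3c > b > c > 0 such that
l₂(a, b, b, b, b, b, c, c, c) = 0 and L₁(a, b, b, b, b, b, c, c, c) is positive semidefinite. -/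
theorem no_nu153_l2_zero :
    ¬ ∃ b c : ℝ, b < 1 - 5 * b - 3 * c ∧ c < b ∧ 0 < c ∧
      l2 ![1 - 5 * b - 3 * c, b, b, b, b, b, c, c, c] = 0 ∧
      (L1m ![1 - 5 * b - 3 * c, b, b, b, b, b, c, c, c]).PosSemidef := by
  rintro ⟨b, c, hab, hcb, hc, hl, hpsd⟩
  have hd := hpsd.det_nonneg
  simp [L1m, l2, L2m, Matrix.det_fin_three] at hd hl
  generalize 1 - 5 * b - 3 * c = a at hab hd hl
  have hb : 0 < b := hc.trans hcb
  have h2 : (a - c) ^ 2 ≤ 4 * c ^ 2 := by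
    by_contra! h
    nlinarith [mul_pos hb (sub_pos.2 h)]
  have h3 : 4 * b * c = (a - c) ^ 2 + (b - c) ^ 2 := by
    have : b * (4 * b * c - ((a - c) ^ 2 + (b - c) ^ 2)) = 0 := by linarith
    have := (mul_eq_zero.1 this).resolve_left hb.ne'
    linarith
  have h4 : b - c < 2 * c := by
    have : a - c ≤ 2 * c := by nlinarith
    linarith
  nlinarith [mul_pos (sub_pos.2 hcb) (sub_pos.2 h4), mul_pos (sub_pos.2 hcb) hc]
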